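/- Define R₁(h,t,θ) by R(h,t,θ) = −ω^p d^{1/p} (ωh)^{1/p} v(θ) f(t) − R₁(h,t,θ). Then there exist constants C' > 0 and h₀ such that |D_h^i D_t^j R₁(h,t,θ)| ≤ C' · h^{-i/q} for all 0 ≤ i+j ≤ 21, all θ, all t, and all h ≥ h₀. -/

import Mathlib

/-- The one-dimensional `p`-Laplacian nonlinearity `φ_p(s) = |s|^{p-2} s`. -/
noncomputable def phi (p s : ℝ) : ℝ := |s| ^ (p - 2) * s

/-- The `p`-analogue of `π`: `π_p = 2π (p-1)^{1/p} / (p sin(π/p))`. -/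
noncomputable def pip (p : ℝ) : ℝ :=
  2 * Real.pi * (p - 1) ^ (1 / p) / (p * Real.sin (Real.pi / p))

/-- Mixed partial derivative `D_x^i D_t^j F(x,t)` of a function of two real variables. -/
noncomputable def iterD (F : ℝ → ℝ → ℝ) (i j : ℕ) (x t : ℝ) : ℝ :=
  iteratedDeriv i (fun y => iteratedDeriv j (F y) t) x

section Aux

open Set Metric
open scoped Topology

/-- A family of functions is `n` times continuously differentiable on the open set `s`, with
derivatives up to order `n` bounded on `s` uniformly over the indices in `S`. -/
structure UnifBddCn {ι E F : Type*} [NormedAddCommGroup E] [NormedSpace ℝ E]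
    [NormedAddCommGroup F] [NormedSpace ℝ F] (n : ℕ) (S : Set ι) (s : Set E)
    (f : ι → E → F) : Prop where
  isOpen : IsOpen s
  contDiffOn : ∀ i ∈ S, ContDiffOn ℝ n (f i) s
  exists_bound : ∃ B : ℝ, ∀ i ∈ S, ∀ x ∈ s, ∀ k ≤ n, ‖iteratedFDerivWithin ℝ k (f i) s x‖ ≤ B

namespace UnifBddCn

variable {ι E F G H : Type*} [NormedAddCommGroup E] [NormedSpace ℝ E]
  [NormedAddCommGroup F] [NormedSpace ℝ F] [NormedAddCommGroup G] [NormedSpace ℝ G]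
  [NormedAddCommGroup H] [NormedSpace ℝ H]
  {n m : ℕ} {S T : Set ι} {s : Set E} {t : Set F} {f g : ι → E → F}

theorem mono_order (hf : UnifBddCn n S s f) (h : m ≤ n) : UnifBddCn m S s f := by
  obtain ⟨B, hB⟩ := hf.exists_bound
  exact ⟨hf.isOpen, fun i hi => (hf.contDiffOn i hi).of_le (by exact_mod_cast h),
    B, fun i hi x hx k hk => hB i hi x hx k (hk.trans h)⟩

theorem mono_index (hf : UnifBddCn n S s f) (h : T ⊆ S) : UnifBddCn n T s f := by
  obtain ⟨B, hB⟩ := hf.exists_bound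
  exact ⟨hf.isOpen, fun i hi => hf.contDiffOn i (h hi), B, fun i hi => hB i (h hi)⟩

theorem congr (hf : UnifBddCn n S s f) (h : ∀ i ∈ S, ∀ x ∈ s, g i x = f i x) :
    UnifBddCn n S s g := by
  obtain ⟨B, hB⟩ := hf.exists_bound
  refine ⟨hf.isOpen, fun i hi => (hf.contDiffOn i hi).congr (h i hi), B,
    fun i hi x hx k hk => ?_⟩
  rw [iteratedFDerivWithin_congr (h i hi) hx]
  exact hB i hi x hx k hk

theorem exists_pos_bound (hf : UnifBddCn n S s f) : ∃ B : ℝ, 1 ≤ B ∧ ∀ i ∈ S, ∀ x ∈ s, ∀ k ≤ n,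
    ‖iteratedFDerivWithin ℝ k (f i) s x‖ ≤ B := by
  obtain ⟨B, hB⟩ := hf.exists_bound
  exact ⟨max 1 B, le_max_left _ _, fun i hi x hx k hk =>
    (hB i hi x hx k hk).trans (le_max_right _ _)⟩

theorem exists_norm_le (hf : UnifBddCn n S s f) :
    ∃ B : ℝ, 0 ≤ B ∧ ∀ i ∈ S, ∀ x ∈ s, ‖f i x‖ ≤ B := by
  obtain ⟨B, hB1, hB⟩ := hf.exists_pos_bound
  refine ⟨B, by linarith, fun i hi x hx => ?_⟩
  simpa using hB i hi x hx 0 (Nat.zero_le _)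

theorem zero_iff : UnifBddCn 0 S s f ↔ IsOpen s ∧ (∀ i ∈ S, ContinuousOn (f i) s) ∧
    ∃ B : ℝ, ∀ i ∈ S, ∀ x ∈ s, ‖f i x‖ ≤ B := by
  constructor
  · intro h
    obtain ⟨B, -, hB⟩ := h.exists_norm_le
    exact ⟨h.isOpen, fun i hi => (h.contDiffOn i hi).continuousOn, B, hB⟩
  · rintro ⟨h1, h2, B, h3⟩
    refine ⟨h1, fun i hi => by simpa using h2 i hi, B, fun i hi x hx k hk => ?_⟩
    obtain rfl : k = 0 := by omega
    simpa using h3 i hi x hx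

theorem succ_of_hasFDerivAt {f' : ι → E → E →L[ℝ] F} (hf' : UnifBddCn n S s f')
    (hf : ∀ i ∈ S, ∀ x ∈ s, HasFDerivAt (f i) (f' i x) x)
    (hb : ∃ B : ℝ, ∀ i ∈ S, ∀ x ∈ s, ‖f i x‖ ≤ B) : UnifBddCn (n + 1) S s f := by
  obtain ⟨B, hB1, hB⟩ := hf'.exists_pos_bound
  obtain ⟨B', hB'⟩ := hb
  have hs := hf'.isOpen
  have hu := hs.uniqueDiffOn (𝕜 := ℝ)
  have heq : ∀ i ∈ S, EqOn (fderivWithin ℝ (f i) s) (f' i) s := fun i hi x hx =>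
    (hf i hi x hx).hasFDerivWithinAt.fderivWithin (hu x hx)
  refine ⟨hs, fun i hi => ?_, max B B', fun i hi x hx k hk => ?_⟩
  · have : ((n + 1 : ℕ) : WithTop ℕ∞) = (n : WithTop ℕ∞) + 1 := by push_cast; rfl
    rw [this, contDiffOn_succ_iff_fderivWithin hu]
    refine ⟨fun x hx => (hf i hi x hx).differentiableAt.differentiableWithinAt, ?_,
      (hf'.contDiffOn i hi).congr (heq i hi)⟩
    intro h; simp at h
  · rcases k with _ | k
    · simpa using (hB' i hi x hx).trans (le_max_right _ _)
    · rw [← norm_iteratedFDerivWithin_fderivWithin hu hx,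
        iteratedFDerivWithin_congr (heq i hi) hx]
      exact (hB i hi x hx k (by omega)).trans (le_max_left _ _)

theorem fderiv (hf : UnifBddCn (n + 1) S s f) : UnifBddCn n S s (fun i => fderiv ℝ (f i)) := by
  obtain ⟨B, hB⟩ := hf.exists_bound
  have hs := hf.isOpen
  have hu := hs.uniqueDiffOn (𝕜 := ℝ)
  have heq : ∀ i, EqOn (_root_.fderiv ℝ (f i)) (fderivWithin ℝ (f i) s) s := fun i x hx =>
    (fderivWithin_of_isOpen hs hx).symm
  refine ⟨hs, fun i hi => ?_, B, fun i hi x hx k hk => ?_⟩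
  · exact (hf.contDiffOn i hi).fderiv_of_isOpen hs (by push_cast; rfl)
  · rw [iteratedFDerivWithin_congr (heq i) hx, norm_iteratedFDerivWithin_fderivWithin hu hx]
    exact hB i hi x hx _ (by omega)

theorem differentiableAt (hf : UnifBddCn (n + 1) S s f) {i : ι} (hi : i ∈ S) {x : E}
    (hx : x ∈ s) : DifferentiableAt ℝ (f i) x :=
  ((hf.contDiffOn i hi).differentiableOn (by simp)).differentiableAt (hf.isOpen.mem_nhds hx)

theorem const (hs : IsOpen s) {c : ι → F} {C : ℝ} (hc : ∀ i ∈ S, ‖c i‖ ≤ C) :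
    UnifBddCn n S s (fun i _ => c i) := by
  refine ⟨hs, fun i _ => contDiffOn_const, max C 0, fun i hi x hx k hk => ?_⟩
  rcases k with _ | k
  · simpa using Or.inl (hc i hi)
  · rw [iteratedFDerivWithin_const_of_ne (by omega)]
    simp

theorem add (hf : UnifBddCn n S s f) (hg : UnifBddCn n S s g) :
    UnifBddCn n S s (fun i x => f i x + g i x) := by
  obtain ⟨B, hB⟩ := hf.exists_bound
  obtain ⟨B', hB'⟩ := hg.exists_bound
  refine ⟨hf.isOpen, fun i hi => (hf.contDiffOn i hi).add (hg.contDiffOn i hi), B + B',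
    fun i hi x hx k hk => ?_⟩
  have hk' : (k : WithTop ℕ∞) ≤ n := by exact_mod_cast hk
  rw [fun_iteratedFDerivWithin_add_apply (((hf.contDiffOn i hi).of_le hk') x hx)
    (((hg.contDiffOn i hi).of_le hk') x hx) (hf.isOpen.uniqueDiffOn) hx]
  exact (norm_add_le _ _).trans (add_le_add (hB i hi x hx k hk) (hB' i hi x hx k hk))

theorem bilinear (L : F →L[ℝ] G →L[ℝ] H) {g : ι → E → G} (hf : UnifBddCn n S s f)
    (hg : UnifBddCn n S s g) : UnifBddCn n S s (fun i x => L (f i x) (g i x)) := by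
  obtain ⟨B, hB1, hB⟩ := hf.exists_pos_bound
  obtain ⟨B', hB1', hB'⟩ := hg.exists_pos_bound
  refine ⟨hf.isOpen, fun i hi => ContDiffOn.clm_apply
    (L.contDiff.comp_contDiffOn (hf.contDiffOn i hi)) (hg.contDiffOn i hi),
    ‖L‖ * (2 ^ n * B * B'), fun i hi x hx k hk => ?_⟩
  have hk' : (k : WithTop ℕ∞) ≤ n := by exact_mod_cast hk
  refine (L.norm_iteratedFDerivWithin_le_of_bilinear (hf.contDiffOn i hi) (hg.contDiffOn i hi)
    hf.isOpen.uniqueDiffOn hx hk').trans ?_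
  gcongr
  calc _ ≤ ∑ j ∈ Finset.range (k + 1), (k.choose j : ℝ) * B * B' := by
        gcongr with j hj
        · exact hB i hi x hx j (by simp at hj; omega)
        · exact hB' i hi x hx _ (by omega)
    _ = 2 ^ k * B * B' := by
        rw [← Finset.sum_mul, ← Finset.sum_mul]
        congr 2
        exact_mod_cast Nat.sum_range_choose k
    _ ≤ 2 ^ n * B * B' := by
        gcongr
        norm_num

theorem mul {f g : ι → E → ℝ} (hf : UnifBddCn n S s f) (hg : UnifBddCn n S s g) :
    UnifBddCn n S s (fun i x => f i x * g i x) :=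
  hf.bilinear (ContinuousLinearMap.mul ℝ ℝ) hg

theorem const_mul {f : ι → E → ℝ} (hf : UnifBddCn n S s f) {c : ι → ℝ} {C : ℝ}
    (hc : ∀ i ∈ S, |c i| ≤ C) : UnifBddCn n S s (fun i x => c i * f i x) :=
  (const hf.isOpen hc).mul hf

theorem clm_comp (L : F →L[ℝ] G) (hf : UnifBddCn n S s f) :
    UnifBddCn n S s (fun i x => L (f i x)) :=
  (const (c := fun _ => L) hf.isOpen (fun _ _ => le_rfl)).bilinear
    (ContinuousLinearMap.id ℝ (F →L[ℝ] G)) hf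

theorem prodMk {g : ι → E → G} (hf : UnifBddCn n S s f) (hg : UnifBddCn n S s g) :
    UnifBddCn n S s (fun i x => (f i x, g i x)) :=
  ((hf.clm_comp (ContinuousLinearMap.inl ℝ F G)).add
    (hg.clm_comp (ContinuousLinearMap.inr ℝ F G))).congr (by simp)

theorem clm (L : E →L[ℝ] F) (hs : IsOpen s) (hb : Bornology.IsBounded s) :
    UnifBddCn n S s (fun _ x => L x) := by
  obtain ⟨B, hB⟩ := hb.exists_norm_le
  have : UnifBddCn (n + 1) S s (fun (_ : ι) x => L x) :=
    succ_of_hasFDerivAt (f' := fun _ _ => L) (const hs (fun _ _ => le_rfl))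
      (fun i _ x _ => L.hasFDerivAt) ⟨‖L‖ * B, fun i _ x hx =>
        (L.le_opNorm x).trans (by gcongr; exact hB x hx)⟩
  exact this.mono_order (Nat.le_succ n)

theorem comp {g : ι → F → G} (hg : UnifBddCn n S t g) (hf : UnifBddCn n S s f)
    (h : ∀ i ∈ S, MapsTo (f i) s t) : UnifBddCn n S s (fun i x => g i (f i x)) := by
  obtain ⟨B, hB1, hB⟩ := hg.exists_pos_bound
  obtain ⟨D, hD1, hD⟩ := hf.exists_pos_bound
  refine ⟨hf.isOpen, fun i hi => (hg.contDiffOn i hi).comp (hf.contDiffOn i hi) (h i hi),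
    n.factorial * B * D ^ n, fun i hi x hx k hk => ?_⟩
  have hk' : (k : WithTop ℕ∞) ≤ n := by exact_mod_cast hk
  refine (norm_iteratedFDerivWithin_comp_le (hg.contDiffOn i hi) (hf.contDiffOn i hi) hk'
    hg.isOpen.uniqueDiffOn hf.isOpen.uniqueDiffOn (h i hi) hx
    (C := B) (D := D) (fun j hj => hB i hi _ (h i hi hx) j (hj.trans hk))
    (fun j hj1 hj => (hD i hi x hx j (hj.trans hk)).trans
      (le_self_pow₀ hD1 (by omega)))).trans ?_
  gcongr

theorem comp_const_add {f : E → F} (hf : UnifBddCn n (univ : Set Unit) univ (fun _ => f))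
    (hs : IsOpen s) (a : ι → E) : UnifBddCn n S s (fun i x => f (a i + x)) := by
  obtain ⟨B, hB⟩ := hf.exists_bound
  have hc : ContDiff ℝ n f := contDiffOn_univ.1 (hf.contDiffOn () (mem_univ _))
  refine ⟨hs, fun i _ => (hc.comp (contDiff_const.add contDiff_id)).contDiffOn, B,
    fun i _ x hx k hk => ?_⟩
  rw [iteratedFDerivWithin_of_isOpen k hs hx, iteratedFDeriv_comp_add_left,
    ← iteratedFDerivWithin_univ]
  exact hB () (mem_univ _) _ (mem_univ _) k hk

end UnifBddCn

namespace UnifBddCn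

variable {ι E : Type*} [NormedAddCommGroup E] [NormedSpace ℝ E]

theorem succ_of_hasDerivAt {n : ℕ} {S : Set ι} {s : Set ℝ} {f f' : ι → ℝ → ℝ}
    (hf' : UnifBddCn n S s f') (hf : ∀ i ∈ S, ∀ x ∈ s, HasDerivAt (f i) (f' i x) x)
    (hb : ∃ B : ℝ, ∀ i ∈ S, ∀ x ∈ s, ‖f i x‖ ≤ B) : UnifBddCn (n + 1) S s f :=
  succ_of_hasFDerivAt (hf'.clm_comp (ContinuousLinearMap.toSpanSingletonCLE (𝕜 := ℝ) (E := ℝ)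
    : ℝ →L[ℝ] ℝ →L[ℝ] ℝ)) (fun i hi x hx => (hf i hi x hx).hasFDerivAt) hb

theorem one_add_mul_rpow (n : ℕ) {S : Set ι} {s : Set ℝ} (hs : IsOpen s) {ε : ι → ℝ}
    (hε : ∀ i ∈ S, |ε i| ≤ 1) (hx : ∀ i ∈ S, ∀ x ∈ s, |ε i * x| ≤ 1 / 2) {c : ι → ℝ} {C : ℝ}
    (hc : ∀ i ∈ S, |c i| ≤ C) (b : ℝ) :
    UnifBddCn n S s (fun i x => c i * (1 + ε i * x) ^ b) := by
  have hpos : ∀ i ∈ S, ∀ x ∈ s, 1 / 2 ≤ 1 + ε i * x ∧ 1 + ε i * x ≤ 2 := fun i hi x hxs => by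
    have := abs_le.1 (hx i hi x hxs)
    constructor <;> linarith
  have hbd : ∀ {c : ι → ℝ} {C : ℝ}, (∀ i ∈ S, |c i| ≤ C) → ∀ b : ℝ, ∀ i ∈ S, ∀ x ∈ s,
      ‖c i * (1 + ε i * x) ^ b‖ ≤ C * (2 : ℝ) ^ |b| := by
    intro c C hc b i hi x hxs
    obtain ⟨h1, h2⟩ := hpos i hi x hxs
    have h0 : 0 < 1 + ε i * x := by linarith
    rw [norm_mul, Real.norm_eq_abs, Real.norm_eq_abs, abs_of_pos (Real.rpow_pos_of_pos h0 _)]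
    have hC : 0 ≤ C := (abs_nonneg _).trans (hc i hi)
    gcongr
    · exact hc i hi
    · rcases le_total 0 b with hb | hb
      · rw [abs_of_nonneg hb]
        exact Real.rpow_le_rpow h0.le h2 hb
      · rw [abs_of_nonpos hb, ← neg_neg b, Real.rpow_neg_eq_inv_rpow, neg_neg]
        refine Real.rpow_le_rpow (inv_nonneg.2 h0.le) ?_ (by linarith)
        exact (inv_le_comm₀ h0 two_pos).2 (by linarith)
  induction n generalizing c C b with
  | zero =>
    refine zero_iff.2 ⟨hs, fun i hi => ?_, C * (2 : ℝ) ^ |b|, hbd hc b⟩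
    refine continuousOn_const.mul (ContinuousOn.rpow_const (by fun_prop) fun x hxs => Or.inl ?_)
    have := (hpos i hi x hxs).1
    linarith
  | succ n ih =>
    have hc' : ∀ i ∈ S, |c i * ε i * b| ≤ C * 1 * |b| := fun i hi => by
      rw [abs_mul, abs_mul]
      have hC : 0 ≤ C := (abs_nonneg _).trans (hc i hi)
      gcongr
      · exact hc i hi
      · exact hε i hi
    refine succ_of_hasDerivAt (ih hc' (b - 1)) (fun i hi x hxs => ?_) ⟨C * (2 : ℝ) ^ |b|, hbd hc b⟩
    have h0 : 1 + ε i * x ≠ 0 := by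
      have := (hpos i hi x hxs).1
      linarith
    have h := ((((hasDerivAt_id x).const_mul (ε i)).const_add 1).rpow_const
      (p := b) (Or.inl h0)).const_mul (c i)
    exact h.congr_deriv (by simp only [id_eq]; ring)

theorem mul_one_add_mul_rpow_sub_one (n : ℕ) {S : Set ι} {s : Set ℝ} (hs : IsOpen s)
    (hb : Bornology.IsBounded s) {ε : ι → ℝ}
    (hε : ∀ i ∈ S, |ε i| ≤ 1) (hx : ∀ i ∈ S, ∀ x ∈ s, |ε i * x| ≤ 1 / 2)
    {c : ι → ℝ} {C : ℝ} (hc : ∀ i ∈ S, |c i * ε i| ≤ C) {a : ℝ} (ha : 0 ≤ a) (ha1 : a ≤ 1) :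
    UnifBddCn n S s (fun i x => c i * ((1 + ε i * x) ^ a - 1)) := by
  obtain ⟨B, hB⟩ := hb.exists_norm_le
  have hc' : ∀ i ∈ S, |c i * ε i * a| ≤ C * |a| := fun i hi => by
    rw [abs_mul]
    gcongr
    exact hc i hi
  refine (succ_of_hasDerivAt (one_add_mul_rpow n hs hε hx hc' (a - 1)) (fun i hi x hxs => ?_)
      ⟨C * B, fun i hi x hxs => ?_⟩).mono_order (Nat.le_succ n)
  · have h0 : 1 + ε i * x ≠ 0 := by
      have := abs_le.1 (hx i hi x hxs)
      linarith
    have h := (((((hasDerivAt_id x).const_mul (ε i)).const_add 1).rpow_const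
      (p := a) (Or.inl h0)).sub_const 1).const_mul (c i)
    exact h.congr_deriv (by simp only [id_eq]; ring)
  · have h := abs_le.1 (hx i hi x hxs)
    have h1 : |(1 + ε i * x) ^ a - 1| ≤ |ε i * x| := by
      have hup := rpow_one_add_le_one_add_mul_self (s := ε i * x) (by linarith) ha ha1
      rcases le_total 0 (ε i * x) with h0 | h0
      · have := Real.one_le_rpow (by linarith : 1 ≤ 1 + ε i * x) ha
        rw [abs_of_nonneg (by linarith), abs_of_nonneg h0]
        nlinarith
      · have h2 := Real.rpow_le_rpow_of_exponent_ge (by linarith : 0 < 1 + ε i * x)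
          (by linarith) ha1
        rw [Real.rpow_one] at h2
        have := Real.rpow_le_one (by linarith) (by linarith : 1 + ε i * x ≤ 1) ha
        rw [abs_of_nonpos (by linarith), abs_of_nonpos h0]
        linarith
    calc ‖c i * ((1 + ε i * x) ^ a - 1)‖ ≤ |c i| * |ε i * x| := by
          rw [norm_mul, Real.norm_eq_abs, Real.norm_eq_abs]
          gcongr
      _ = |c i * ε i| * |x| := by rw [abs_mul, abs_mul, mul_assoc]
      _ ≤ C * B := mul_le_mul (hc i hi) (hB x hxs) (abs_nonneg _)
          ((abs_nonneg _).trans (hc i hi))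

/-- Solutions of `w = K (x, δ w)` inherit uniform bounds from `K` when `δ` is small. -/
theorem of_implicit {n : ℕ} {S : Set ι} {U : Set E} {V : Set ℝ} (hU : IsOpen U)
    (hUb : Bornology.IsBounded U) (hUc : Convex ℝ U) (hVc : Convex ℝ V)
    {K : ι → E × ℝ → ℝ} (hK : UnifBddCn (n + 1) S (U ×ˢ V) K) :
    ∃ η > 0, ∀ T ⊆ S, ∀ δ : ι → ℝ, (∀ i ∈ T, 0 ≤ δ i ∧ δ i ≤ η) → ∀ w : ι → E → ℝ,
      (∀ i ∈ T, ∀ x ∈ U, δ i * w i x ∈ V ∧ w i x = K i (x, δ i * w i x)) →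
      UnifBddCn (n + 1) T U w := by
  obtain ⟨B, hB0, hB⟩ := hK.fderiv.exists_norm_le
  obtain ⟨B₀, hB₀0, hB₀⟩ := hK.exists_norm_le
  refine ⟨1 / (2 * (B + 1)), by positivity, fun T hTS δ hδ w hw => ?_⟩
  have hδB : ∀ i ∈ T, δ i * B < 1 / 2 := fun i hi => by
    have h1 := (hδ i hi).1
    have h2 := (hδ i hi).2
    rw [le_div_iff₀ (by positivity)] at h2
    rcases h1.eq_or_lt with h | h
    · rw [← h]; norm_num
    · nlinarith
  have hmem : ∀ i ∈ T, ∀ x ∈ U, (x, δ i * w i x) ∈ U ×ˢ V := fun i hi x hx =>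
    ⟨hx, (hw i hi x hx).1⟩
  have hδ1 : ∀ i ∈ T, |δ i| ≤ 1 / (2 * (B + 1)) := fun i hi => by
    rw [abs_of_nonneg (hδ i hi).1]; exact (hδ i hi).2
  have hlip : ∀ i ∈ T, ∀ x ∈ U, ∀ y ∈ U, |w i y - w i x| ≤ 2 * B * ‖y - x‖ := by
    intro i hi x hx y hy
    have h := (hUc.prod hVc).norm_image_sub_le_of_norm_fderiv_le
      (fun z hz => hK.differentiableAt (hTS hi) hz) (fun z hz => hB i (hTS hi) z hz)
      (hmem i hi x hx) (hmem i hi y hy)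
    rw [← (hw i hi x hx).2, ← (hw i hi y hy).2, Real.norm_eq_abs] at h
    have h2 : ‖(y, δ i * w i y) - (x, δ i * w i x)‖ ≤ ‖y - x‖ + δ i * |w i y - w i x| := by
      refine (Prod.norm_def _).trans_le (max_le ?_ ?_)
      · exact le_add_of_nonneg_right (mul_nonneg (hδ i hi).1 (abs_nonneg _))
      · simp only [Prod.mk_sub_mk, ← mul_sub, norm_mul, Real.norm_eq_abs,
          abs_of_nonneg (hδ i hi).1]
        exact le_add_of_nonneg_left (norm_nonneg _)
    have h3 := mul_le_mul_of_nonneg_left h2 hB0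
    have h4 := mul_le_mul_of_nonneg_right (hδB i hi).le (abs_nonneg (w i y - w i x))
    nlinarith
  have hℓ : ∀ i ∈ T, ∀ z ∈ U ×ˢ V, |(-δ i) * _root_.fderiv ℝ (K i) z (0, 1)| < 1 / 2 := by
    intro i hi z hz
    refine lt_of_le_of_lt ?_ (hδB i hi)
    rw [abs_mul, abs_neg, abs_of_nonneg (hδ i hi).1]
    refine mul_le_mul_of_nonneg_left ?_ (hδ i hi).1
    refine ((_root_.fderiv ℝ (K i) z).le_opNorm _).trans ?_
    simpa [Prod.norm_def] using hB i (hTS hi) z hz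
  let Λ : ι → E × ℝ → E →L[ℝ] ℝ := fun i z =>
    (1 + (-δ i) * _root_.fderiv ℝ (K i) z (0, 1)) ^ (-1 : ℝ) •
      (_root_.fderiv ℝ (K i) z).comp (ContinuousLinearMap.inl ℝ E ℝ)
  have hderiv : ∀ i ∈ T, ∀ x ∈ U, HasFDerivAt (w i) (Λ i (x, δ i * w i x)) x := by
    intro i hi x hx
    have hlipO : (fun y => w i y - w i x) =O[𝓝 x] (fun y => y - x) :=
      Asymptotics.IsBigO.of_bound (2 * B) (by
        filter_upwards [hU.mem_nhds hx] with y hy using hlip i hi x hx y hy)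
    have hφO : (fun y => (y, δ i * w i y) - (x, δ i * w i x)) =O[𝓝 x] (fun y => y - x) := by
      simp only [Prod.mk_sub_mk, ← mul_sub]
      exact (Asymptotics.isBigO_refl _ _).prod_left (hlipO.const_mul_left _)
    have hφ : Filter.Tendsto (fun y => (y, δ i * w i y)) (𝓝 x) (𝓝 (x, δ i * w i x)) := by
      rw [← tendsto_sub_nhds_zero_iff]
      refine hφO.trans_tendsto ?_
      rw [tendsto_sub_nhds_zero_iff]
      exact Filter.tendsto_id
    have h0 := (hK.differentiableAt (hTS hi) (hmem i hi x hx)).hasFDerivAt.isLittleO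
    have h1 := ((h0.comp_tendsto hφ).trans_isBigO hφO).const_mul_left
      ((1 + (-δ i) * _root_.fderiv ℝ (K i) (x, δ i * w i x) (0, 1)) ^ (-1 : ℝ))
    refine HasFDerivAt.of_isLittleO (h1.congr' ?_ Filter.EventuallyEq.rfl)
    filter_upwards [hU.mem_nhds hx] with y hy
    have hne : 1 + (-δ i) * _root_.fderiv ℝ (K i) (x, δ i * w i x) (0, 1) ≠ 0 := by
      have := abs_lt.1 (hℓ i hi _ (hmem i hi x hx))
      linarith
    have hsplit : ((y, δ i * w i y) - (x, δ i * w i x) : E × ℝ) =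
        ((y - x, 0) : E × ℝ) + (δ i * (w i y - w i x)) • ((0, 1) : E × ℝ) := by
      simp [mul_sub]
    simp only [Function.comp_apply, ← (hw i hi x hx).2, ← (hw i hi y hy).2, Λ, hsplit, map_add,
      map_smul, smul_apply, ContinuousLinearMap.comp_apply,
      ContinuousLinearMap.inl_apply, smul_eq_mul, Real.rpow_neg_one]
    linear_combination (w i y - w i x) * inv_mul_cancel₀ hne
  have hΛ : UnifBddCn n T (U ×ˢ V) Λ := by
    have hf := hK.fderiv.mono_index hTS
    have h1 : UnifBddCn n T (U ×ˢ V) (fun i z => (-δ i) * _root_.fderiv ℝ (K i) z (0, 1)) :=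
      (hf.clm_comp (ContinuousLinearMap.apply ℝ ℝ ((0, 1) : E × ℝ))).const_mul
        (c := fun i => -δ i) (fun i hi => by rw [abs_neg]; exact hδ1 i hi)
    have h2 := (one_add_mul_rpow n (S := T) (s := ball (0 : ℝ) (1 / 2)) isOpen_ball
      (ε := fun _ => 1) (c := fun _ => 1) (C := 1) (by simp)
      (fun i _ x hx => by simpa using (mem_ball_zero_iff.1 hx).le) (by simp) (-1)).comp h1
      (fun i hi z hz => by simpa using hℓ i hi z hz)
    have h3 := h2.bilinear (ContinuousLinearMap.lsmul ℝ ℝ)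
      (hf.clm_comp ((ContinuousLinearMap.compL ℝ E (E × ℝ) ℝ).flip (ContinuousLinearMap.inl ℝ E ℝ)))
    exact h3.congr (by simp [Λ])
  have hwb : ∃ B : ℝ, ∀ i ∈ T, ∀ x ∈ U, ‖w i x‖ ≤ B := ⟨B₀, fun i hi x hx => by
    rw [(hw i hi x hx).2]
    exact hB₀ i (hTS hi) _ (hmem i hi x hx)⟩
  suffices ∀ k ≤ n + 1, UnifBddCn k T U w from this _ le_rfl
  intro k hk
  induction k with
  | zero =>
    exact zero_iff.2 ⟨hU, fun i hi x hx =>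
      (hderiv i hi x hx).continuousAt.continuousWithinAt, hwb⟩
  | succ k ih =>
    exact succ_of_hasFDerivAt ((hΛ.mono_order (by omega)).comp
      ((clm (ContinuousLinearMap.id ℝ E) hU hUb).prodMk
        ((ih (by omega)).const_mul (c := δ) hδ1)) (fun i hi x hx => hmem i hi x hx)) hderiv hwb

end UnifBddCn

/-- The derivative of `f` in the direction `v`, as a function. -/
noncomputable def dirDeriv {E F : Type*} [NormedAddCommGroup E] [NormedSpace ℝ E]
    [NormedAddCommGroup F] [NormedSpace ℝ F] (v : E) (f : E → F) : E → F :=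
  fun x => fderiv ℝ f x v

theorem iterate_dirDeriv_comm {E F : Type*} [NormedAddCommGroup E] [NormedSpace ℝ E]
    [NormedAddCommGroup F] [NormedSpace ℝ F] {f : E → F} (u v : E) (n : ℕ)
    (hf : ContDiff ℝ (n + 1 : ℕ) f) :
    (dirDeriv v)^[n] (dirDeriv u f) = dirDeriv u ((dirDeriv v)^[n] f) := by
  induction n generalizing f with
  | zero => rfl
  | succ n ih =>
    have hf' : ContDiff ℝ (n + 1 : ℕ) (dirDeriv v f) :=
      (hf.fderiv_right (m := (n + 1 : ℕ)) (by push_cast; rfl)).clm_apply contDiff_const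
    have hd : Differentiable ℝ (fderiv ℝ f) :=
      (hf.fderiv_right (m := 1) (by push_cast; rw [add_assoc]; exact le_add_self)).differentiable
        (by simp)
    have hcomm : dirDeriv v (dirDeriv u f) = dirDeriv u (dirDeriv v f) := by
      funext x
      have hsymm : IsSymmSndFDerivAt ℝ f x := hf.contDiffAt.isSymmSndFDerivAt (by
        rw [minSmoothness_of_isRCLikeNormedField]
        exact_mod_cast (by omega : 2 ≤ n + 1 + 1))
      have key : ∀ a b : E, dirDeriv a (dirDeriv b f) x = fderiv ℝ (fderiv ℝ f) x a b := by
        intro a b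
        unfold dirDeriv
        rw [fderiv_clm_apply (hd x) (differentiableAt_const b)]
        simp
      rw [key, key, hsymm.eq]
    rw [Function.iterate_succ_apply, Function.iterate_succ_apply, hcomm, ih hf']

theorem ContDiffOn.dirDeriv {E F : Type*} [NormedAddCommGroup E] [NormedSpace ℝ E]
    [NormedAddCommGroup F] [NormedSpace ℝ F] {f : E → F} {s : Set E} {n : ℕ} (hs : IsOpen s)
    (hf : ContDiffOn ℝ (n + 1 : ℕ) f s) (v : E) : ContDiffOn ℝ n (dirDeriv v f) s :=
  (hf.fderiv_of_isOpen hs (by push_cast; rfl)).clm_apply contDiffOn_const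

theorem ContDiffOn.iterate_dirDeriv {E F : Type*} [NormedAddCommGroup E] [NormedSpace ℝ E]
    [NormedAddCommGroup F] [NormedSpace ℝ F] {f : E → F} {s : Set E} {n m : ℕ} (hs : IsOpen s)
    (hf : ContDiffOn ℝ (n + m : ℕ) f s) (v : E) :
    ContDiffOn ℝ n ((_root_.dirDeriv v)^[m] f) s := by
  induction m generalizing f with
  | zero => exact hf
  | succ m ih => exact ih (hf.dirDeriv hs v)

theorem iteratedDeriv_line {E F : Type*} [NormedAddCommGroup E] [NormedSpace ℝ E]
    [NormedAddCommGroup F] [NormedSpace ℝ F] {f : E → F} {s : Set E} {n : ℕ} (hs : IsOpen s)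
    (hf : ContDiffOn ℝ n f s) (x v : E) {t : ℝ} (ht : x + t • v ∈ s) :
    iteratedDeriv n (fun τ => f (x + τ • v)) t = (dirDeriv v)^[n] f (x + t • v) := by
  induction n generalizing f with
  | zero => simp
  | succ n ih =>
    rw [iteratedDeriv_succ', Function.iterate_succ_apply, ← ih (hf.dirDeriv hs v)]
    refine Filter.EventuallyEq.iteratedDeriv_eq n ?_
    have hc : Continuous fun τ : ℝ => x + τ • v := by fun_prop
    filter_upwards [(hs.preimage hc).mem_nhds ht] with τ hτ
    have hl : HasDerivAt (fun τ : ℝ => x + τ • v) v τ := by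
      simpa using ((hasDerivAt_id τ).smul_const v).const_add x
    have hd : DifferentiableAt ℝ f (x + τ • v) :=
      (hf.differentiableOn (by simp)).differentiableAt (hs.mem_nhds hτ)
    exact (hd.hasFDerivAt.comp_hasDerivAt τ hl).deriv

theorem iterD_eq_iterate_dirDeriv {f : ℝ × ℝ → ℝ} {n : ℕ} {s : Set (ℝ × ℝ)} (hs : IsOpen s)
    (hf : ContDiffOn ℝ n f s) {i j : ℕ} (hij : i + j ≤ n) {x t : ℝ} (hx : (x, t) ∈ s) :
    iterD (fun a b => f (a, b)) i j x t = (dirDeriv (1, 0))^[i] ((dirDeriv (0, 1))^[j] f) (x, t) := by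
  have hj : ∀ y, (y, t) ∈ s → iteratedDeriv j (fun b => f (y, b)) t =
      (dirDeriv (0, 1))^[j] f (y, t) := by
    intro y hy
    simpa using iteratedDeriv_line hs
      (hf.of_le (by exact_mod_cast (by omega : j ≤ n)) : ContDiffOn ℝ j f s) (y, 0) (0, 1) (t := t)
      (by simpa using hy)
  have hopen : ∀ᶠ y in 𝓝 x, (y, t) ∈ s :=
    (hs.preimage (by fun_prop : Continuous fun y : ℝ => (y, t))).mem_nhds hx
  have h1 := iteratedDeriv_line hs (ContDiffOn.iterate_dirDeriv (n := i) (m := j) hs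
    (hf.of_le (by exact_mod_cast hij)) (0, 1)) (0, t) (1, 0) (t := x) (by simpa using hx)
  rw [iterD, Filter.EventuallyEq.iteratedDeriv_eq i (hopen.mono hj)]
  simpa using h1

theorem iterD_comp_affine (F : ℝ → ℝ → ℝ) (i j : ℕ) (h σ t : ℝ) :
    iterD (fun s τ => F (h + σ * s) (t + τ)) i j 0 0 = σ ^ i * iterD F i j h t := by
  have hmul : ∀ (g : ℝ → ℝ) (n : ℕ) (x : ℝ),
      iteratedDeriv n (fun s => g (σ * s)) x = σ ^ n * iteratedDeriv n g (σ * x) := by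
    intro g n
    induction n with
    | zero => simp
    | succ n ih =>
      intro x
      rw [iteratedDeriv_succ, funext ih, iteratedDeriv_succ, deriv_const_mul_field,
        deriv_comp_mul_left]
      simp [pow_succ, mul_assoc]
  unfold iterD
  have h1 : (fun s => iteratedDeriv j (fun τ => F (h + σ * s) (t + τ)) 0) =
      fun s => iteratedDeriv j (F (h + σ * s)) t := by
    funext s
    rw [iteratedDeriv_comp_const_add]
    simp
  rw [h1, hmul (fun y => iteratedDeriv j (F (h + y)) t),
    iteratedDeriv_comp_const_add i (fun y => iteratedDeriv j (F y) t) h]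
  simp

namespace UnifBddCn

section DirDeriv
variable {ι E F : Type*} [NormedAddCommGroup E] [NormedSpace ℝ E] [NormedAddCommGroup F]
  [NormedSpace ℝ F] {n m : ℕ} {S : Set ι} {s : Set E} {f : ι → E → F}

theorem dirDeriv (hf : UnifBddCn (n + 1) S s f) (v : E) :
    UnifBddCn n S s (fun i => dirDeriv v (f i)) :=
  hf.fderiv.clm_comp (ContinuousLinearMap.apply ℝ F v)

theorem iterate_dirDeriv (hf : UnifBddCn (n + m) S s f) (v : E) :
    UnifBddCn n S s (fun i => (_root_.dirDeriv v)^[m] (f i)) := by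
  induction m generalizing f with
  | zero => exact hf
  | succ m ih => exact ih (hf.dirDeriv v)

end DirDeriv

variable {ι : Type*} {n : ℕ} {S : Set ι} {f : ι → ℝ × ℝ → ℝ}

theorem exists_iterD_le {s : Set (ℝ × ℝ)} (hf : UnifBddCn n S s f) :
    ∃ B : ℝ, 0 < B ∧ ∀ i j, i + j ≤ n → ∀ k ∈ S, ∀ z ∈ s,
      |iterD (fun a b => f k (a, b)) i j z.1 z.2| ≤ B := by
  have h : ∀ p : ℕ × ℕ, ∃ B : ℝ, 0 ≤ B ∧ (p.1 + p.2 ≤ n → ∀ k ∈ S, ∀ z ∈ s,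
      |iterD (fun a b => f k (a, b)) p.1 p.2 z.1 z.2| ≤ B) := by
    rintro ⟨i, j⟩
    by_cases hij : i + j ≤ n
    · obtain ⟨B, hB0, hB⟩ := (((hf.mono_order hij).iterate_dirDeriv (0, 1)).mono_order
        (by omega)).iterate_dirDeriv (n := 0) (m := i) (1, 0) |>.exists_norm_le
      refine ⟨B, hB0, fun _ k hk z hz => ?_⟩
      rw [iterD_eq_iterate_dirDeriv hf.isOpen (hf.contDiffOn k hk) hij hz]
      exact hB k hk z hz
    · exact ⟨0, le_rfl, fun h => absurd h hij⟩
  choose B hB0 hB using h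
  refine ⟨1 + ∑ p ∈ Finset.range (n + 1) ×ˢ Finset.range (n + 1), B p,
    by have := Finset.sum_nonneg fun p (_ : p ∈ Finset.range (n + 1) ×ˢ Finset.range (n + 1)) =>
        hB0 p
       linarith, fun i j hij k hk z hz => ?_⟩
  refine (hB (i, j) hij k hk z hz).trans ?_
  have := Finset.single_le_sum (f := B) (fun p _ => hB0 p)
    (show (i, j) ∈ Finset.range (n + 1) ×ˢ Finset.range (n + 1) by simp; omega)
  linarith

theorem of_iterate_dirDeriv (hf : ∀ k ∈ S, ContDiff ℝ n (f k)) {C : ℝ}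
    (hC : ∀ i j, i + j ≤ n → ∀ k ∈ S, ∀ z,
      |(_root_.dirDeriv (1, 0))^[i] ((_root_.dirDeriv (0, 1))^[j] (f k)) z| ≤ C) :
    UnifBddCn n S univ f := by
  induction n generalizing f with
  | zero =>
    exact zero_iff.2 ⟨isOpen_univ, fun k hk => (hf k hk).continuous.continuousOn, C,
      fun k hk z _ => hC 0 0 le_rfl k hk z⟩
  | succ n ih =>
    have hd : ∀ v : ℝ × ℝ, ∀ k ∈ S, ContDiff ℝ n (_root_.dirDeriv v (f k)) := fun v k hk =>
      ((hf k hk).fderiv_right (m := n) (by push_cast; rfl)).clm_apply contDiff_const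
    have h1 := ih (f := fun k => _root_.dirDeriv (1, 0) (f k)) (hd _) (fun i j hij k hk z => by
      rw [iterate_dirDeriv_comm _ _ _ ((hf k hk).of_le (by exact_mod_cast (by omega))),
        ← Function.iterate_succ_apply]
      exact hC (i + 1) j (by omega) k hk z)
    have h2 := ih (f := fun k => _root_.dirDeriv (0, 1) (f k)) (hd _) (fun i j hij k hk z => by
      rw [← Function.iterate_succ_apply (_root_.dirDeriv (0, 1))]
      exact hC i (j + 1) (by omega) k hk z)
    refine succ_of_hasFDerivAt
      ((h1.clm_comp (ContinuousLinearMap.toSpanSingleton ℝ (ContinuousLinearMap.fst ℝ ℝ ℝ))).add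
        (h2.clm_comp (ContinuousLinearMap.toSpanSingleton ℝ (ContinuousLinearMap.snd ℝ ℝ ℝ))))
      (fun k hk z _ => ?_) ⟨C, fun k hk z _ => hC 0 0 (by omega) k hk z⟩
    refine ((hf k hk).differentiable (by simp) z).hasFDerivAt.congr_fderiv ?_
    ext <;> simp [_root_.dirDeriv]

theorem of_iterD {G : ℝ → ℝ → ℝ} (hG : ContDiff ℝ n (fun z : ℝ × ℝ => G z.1 z.2)) {C : ℝ}
    (hC : ∀ i j : ℕ, i + j ≤ n → ∀ x t : ℝ, |iterD G i j x t| ≤ C) :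
    UnifBddCn n (univ : Set Unit) univ (fun _ (z : ℝ × ℝ) => G z.1 z.2) := by
  refine of_iterate_dirDeriv (C := C) (fun _ _ => hG) fun i j hij _ _ z => ?_
  rw [← iterD_eq_iterate_dirDeriv isOpen_univ hG.contDiffOn hij (mem_univ _)]
  exact hC i j hij z.1 z.2

end UnifBddCn

theorem Function.Periodic.exists_abs_le {f : ℝ → ℝ} {c : ℝ} (hf : Function.Periodic f c)
    (hc : 0 < c) (hcont : Continuous f) : ∃ B : ℝ, ∀ x, |f x| ≤ B := by
  obtain ⟨B, hB⟩ := isCompact_Icc.exists_bound_of_continuousOn (s := Icc 0 c) hcont.continuousOn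
  refine ⟨B, fun x => ?_⟩
  obtain ⟨y, hy, hxy⟩ := hf.exists_mem_Ico₀ hc x
  rw [hxy]
  exact hB y (Ico_subset_Icc_self hy)

theorem Function.Periodic.unifBddCn {f : ℝ → ℝ} {c : ℝ} {n : ℕ} (hf : Function.Periodic f c)
    (hc : 0 < c) (hn : ContDiff ℝ n f) : UnifBddCn n (univ : Set Unit) univ (fun _ => f) := by
  induction n generalizing f with
  | zero =>
    obtain ⟨B, hB⟩ := hf.exists_abs_le hc hn.continuous
    exact UnifBddCn.zero_iff.2 ⟨isOpen_univ, fun _ _ => hn.continuous.continuousOn, B,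
      fun _ _ x _ => hB x⟩
  | succ n ih =>
    obtain ⟨B, hB⟩ := hf.exists_abs_le hc hn.continuous
    have hper : Function.Periodic (deriv f) c := fun x => by
      rw [← deriv_comp_add_const, funext hf]
    have hn' : ContDiff ℝ ((n : WithTop ℕ∞) + 1) f := by exact_mod_cast hn
    exact UnifBddCn.succ_of_hasDerivAt (ih hper (contDiff_succ_iff_deriv.1 hn').2.2)
      (fun _ _ x _ => (hn.differentiable (by simp) x).hasDerivAt) ⟨B, fun _ _ x _ => hB x⟩

theorem hasDerivAt_max_zero_rpow {p : ℝ} (hp : 1 < p) (x : ℝ) :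
    HasDerivAt (fun x : ℝ => max x 0 ^ p) (p * max x 0 ^ (p - 1)) x := by
  rcases lt_trichotomy x 0 with hx | rfl | hx
  · rw [max_eq_right hx.le, Real.zero_rpow (by linarith), mul_zero]
    refine (hasDerivAt_const x (0 : ℝ)).congr_of_eventuallyEq ?_
    filter_upwards [Iio_mem_nhds hx] with y hy
    rw [max_eq_right (le_of_lt hy), Real.zero_rpow (by linarith)]
  · rw [max_self, Real.zero_rpow (by linarith), mul_zero]
    have h0 := hasDerivAt_abs_rpow 0 hp
    simp only [mul_zero] at h0
    rw [hasDerivAt_iff_isLittleO] at h0 ⊢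
    refine (Asymptotics.IsBigO.of_bound 1 (Filter.Eventually.of_forall fun y => ?_)).trans_isLittleO
      h0
    simp only [max_self, abs_zero, Real.zero_rpow (by linarith : p ≠ 0), smul_zero, sub_zero,
      one_mul, Real.norm_eq_abs]
    rw [abs_of_nonneg (by positivity), abs_of_nonneg (by positivity)]
    exact Real.rpow_le_rpow (le_max_right _ _) (max_le (le_abs_self y) (abs_nonneg y)) (by linarith)
  · rw [max_eq_left hx.le]
    refine (Real.hasDerivAt_rpow_const (Or.inl hx.ne')).congr_of_eventuallyEq ?_
    filter_upwards [Ioi_mem_nhds hx] with y hy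
    rw [max_eq_left (le_of_lt hy)]

theorem phi_of_nonneg {p x : ℝ} (hp : 1 < p) (hx : 0 ≤ x) : phi p x = x ^ (p - 1) := by
  rcases hx.eq_or_lt with rfl | hx
  · simp [phi, Real.zero_rpow (by linarith : p - 1 ≠ 0)]
  · rw [phi, abs_of_pos hx, ← Real.rpow_add_one hx.ne']
    ring_nf

theorem phi_conj_phi {p q : ℝ} (hp : 2 ≤ p) (hq : q = p / (p - 1)) (s : ℝ) :
    |phi p s| ^ (q - 2) * phi p s = s := by
  rcases eq_or_ne s 0 with rfl | hs
  · simp [phi]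
  have hs' : 0 < |s| := abs_pos.2 hs
  have h1 : |phi p s| = |s| ^ (p - 1) := by
    rw [phi, abs_mul, abs_of_nonneg (by positivity), ← Real.rpow_add_one hs'.ne']
    ring_nf
  rw [h1, phi, ← Real.rpow_mul hs'.le, ← mul_assoc, ← Real.rpow_add hs']
  have hp1 : p - 1 ≠ 0 := by linarith
  have : (p - 1) * (q - 2) + (p - 2) = 0 := by rw [hq]; field_simp; ring
  rw [this, Real.rpow_zero, one_mul]

/-- Conservation of energy bounds every solution of the asymmetric `p`-Laplacian equation. -/
theorem exists_abs_le_of_asymmetric_oscillator {p a b : ℝ} {v v' : ℝ → ℝ} (hp : 2 ≤ p)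
    (ha : 0 < a) (hb : 0 < b) (hv : ∀ t, HasDerivAt v (v' t) t)
    (hode : ∀ t, HasDerivAt (fun s => phi p (v' s))
      (-a * phi p (max (v t) 0) + b * phi p (max (-v t) 0)) t) :
    ∃ B : ℝ, ∀ t, |v t| ≤ B := by
  obtain ⟨q, hq⟩ : ∃ q, q = p / (p - 1) := ⟨_, rfl⟩
  have hp1 : 0 < p - 1 := by linarith
  have hq1 : 1 < q := by rw [hq, lt_div_iff₀ hp1]; linarith
  let E : ℝ → ℝ := fun t => |phi p (v' t)| ^ q / q + (a * max (v t) 0 ^ p + b * max (-v t) 0 ^ p) / p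
  have hE : ∀ t, HasDerivAt E 0 t := by
    intro t
    have h1 := (hasDerivAt_abs_rpow (phi p (v' t)) hq1).comp t (hode t)
    have h2 := (hasDerivAt_max_zero_rpow (by linarith : 1 < p) (v t)).comp t (hv t)
    have h3 := (hasDerivAt_max_zero_rpow (by linarith : 1 < p) (-v t)).comp t (hv t).neg
    refine ((h1.div_const q).add (((h2.const_mul a).add (h3.const_mul b)).div_const p)).congr_deriv ?_
    rw [phi_of_nonneg (by linarith) (le_max_right _ _),
      phi_of_nonneg (by linarith) (le_max_right _ _), mul_assoc q, phi_conj_phi hp hq]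
    field_simp
    ring
  have hconst : ∀ t, E t = E 0 := fun t =>
    is_const_of_deriv_eq_zero (fun t => (hE t).differentiableAt) (fun t => (hE t).deriv) t 0
  have hp0 : 0 < p := by linarith
  have key : ∀ c x : ℝ, 0 < c → 0 ≤ x → c * x ^ p / p ≤ E 0 → x ≤ (p * E 0 / c) ^ (1 / p) := by
    intro c x hc hx h
    rw [one_div, Real.le_rpow_inv_iff_of_pos hx _ hp0]
    · rw [le_div_iff₀ hc]
      rw [div_le_iff₀ hp0] at h
      linarith
    · have : 0 ≤ E 0 := le_trans (by positivity) h
      positivity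
  refine ⟨max ((p * E 0 / a) ^ (1 / p)) ((p * E 0 / b) ^ (1 / p)), fun t => ?_⟩
  have hq0 : 0 < q := by linarith
  have e1 : 0 ≤ |phi p (v' t)| ^ q / q := by positivity
  have e2 : 0 ≤ a * max (v t) 0 ^ p / p := by positivity
  have e3 : 0 ≤ b * max (-v t) 0 ^ p / p := by positivity
  have e4 : |phi p (v' t)| ^ q / q + (a * max (v t) 0 ^ p / p + b * max (-v t) 0 ^ p / p) = E 0 := by
    rw [← hconst t, ← add_div]
  refine abs_le'.2 ⟨?_, ?_⟩
  · exact (le_max_left _ _).trans ((key a _ ha (le_max_right _ _) (by linarith)).trans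
      (le_max_left _ _))
  · exact (le_max_left _ _).trans ((key b _ hb (le_max_right _ _) (by linarith)).trans
      (le_max_right _ _))

theorem pip_pos {p : ℝ} (hp : 2 ≤ p) : 0 < pip p := by
  unfold pip
  have hsin : 0 < Real.sin (Real.pi / p) :=
    Real.sin_pos_of_pos_of_lt_pi (by positivity)
      (div_lt_self Real.pi_pos (by linarith))
  have : 0 < p - 1 := by linarith
  positivity

theorem exists_rpow_small {a κ : ℝ} (ha : 0 < a) (ha2 : a ≤ 1 / 2) (hκ : 0 < κ) :
    ∃ H : ℝ, 1 ≤ H ∧ ∀ h, H ≤ h → h ^ (-a) ≤ κ ∧ h ^ (a - 1) ≤ κ := by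
  obtain ⟨H, hH⟩ := Filter.eventually_atTop.1
    ((tendsto_rpow_neg_atTop ha).eventually (Iic_mem_nhds hκ))
  refine ⟨max 1 H, le_max_left _ _, fun h hh => ?_⟩
  have h1 := hH h ((le_max_right _ _).trans hh)
  exact ⟨h1, (Real.rpow_le_rpow_of_exponent_le ((le_max_left _ _).trans hh)
    (by linarith)).trans h1⟩

theorem rescaled_radius_eq {a A ω h ρ V F w Z : ℝ} (hω : 0 < ω) (hh : 0 < h) (hρ : 0 < ρ)
    (hZ : Z = A * ω ^ (a - 1) * V * F * ρ ^ (a - 1) + 1 / ω * (h ^ (-a) * w) * ρ ^ (-1 : ℝ)) :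
    ω * (h * ρ) + A * (ω * (h * ρ)) ^ a * V * F + w = ω * (h * ρ) * (1 + h ^ (a - 1) * Z) := by
  have e1 : h * h ^ (a - 1) = h ^ a := by rw [mul_comm, ← Real.rpow_add_one hh.ne']; ring_nf
  have e2 : h ^ a * h ^ (-a) = 1 := by rw [← Real.rpow_add hh]; simp
  have e3 : ω * ω ^ (a - 1) = ω ^ a := by rw [mul_comm, ← Real.rpow_add_one hω.ne']; ring_nf
  have e4 : ρ * ρ ^ (a - 1) = ρ ^ a := by rw [mul_comm, ← Real.rpow_add_one hρ.ne']; ring_nf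
  have e5 : ρ * ρ ^ (-1 : ℝ) = 1 := by rw [Real.rpow_neg_one, mul_inv_cancel₀ hρ.ne']
  have e6 : ω * (1 / ω) = 1 := by field_simp
  rw [hZ, Real.mul_rpow hω.le (by positivity), Real.mul_rpow hh.le hρ.le]
  calc _ = ω * (h * ρ) + A * V * F * (ω ^ a * (h ^ a * ρ ^ a)) + 1 * 1 * 1 * w := by ring
    _ = ω * (h * ρ) + A * V * F * ((ω * ω ^ (a - 1)) * ((h * h ^ (a - 1)) * (ρ * ρ ^ (a - 1))))
        + (ω * (1 / ω)) * ((h * h ^ (a - 1)) * h ^ (-a)) * (ρ * ρ ^ (-1 : ℝ)) * w := by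
        rw [e3, e1, e4, e6, e5, e2]
    _ = _ := by ring

/-- Symbol-type estimates for the remainder, obtained by rescaling around each point
`(h, t)` with step `h ^ (1 - a)` in the first variable. -/
theorem exists_iterD_remainder_le {n : ℕ} {a A c e ω M Vb : ℝ} {v f : ℝ → ℝ} {G : ℝ → ℝ → ℝ}
    {R₁ : ℝ → ℝ → ℝ → ℝ} (ha : 0 < a) (ha2 : a ≤ 1 / 2) (hω : 0 < ω) (hv : ∀ θ, |v θ| ≤ Vb)
    (hf : UnifBddCn (n + 1) (univ : Set Unit) univ (fun _ => f))
    (hG : UnifBddCn (n + 1) (univ : Set Unit) univ (fun _ (z : ℝ × ℝ) => G z.1 z.2))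
    (hM : 0 ≤ M) {h₁ : ℝ}
    (hR₁ : ∀ h, h₁ ≤ h → ∀ t θ, |R₁ h t θ| ≤ M * h ^ a ∧
      R₁ h t θ = A * v θ * f t *
          ((ω * h + A * (ω * h) ^ a * v θ * f t + R₁ h t θ) ^ a - (ω * h) ^ a)
        - c * G (e * (ω * h + A * (ω * h) ^ a * v θ * f t + R₁ h t θ) ^ a * v θ) t) :
    ∃ C' h₀ : ℝ, 0 < C' ∧ 1 ≤ h₀ ∧ ∀ i j : ℕ, i + j ≤ n + 1 → ∀ θ t h : ℝ, h₀ ≤ h →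
      (h ^ (1 - a)) ^ i * |iterD (fun h t => R₁ h t θ) i j h t| ≤ C' := by
  obtain ⟨H₁, hH₁1, hH₁⟩ := exists_rpow_small ha ha2 (by norm_num : (0 : ℝ) < 1 / 2)
  let S : ℝ → Set (ℝ × ℝ × ℝ) := fun H => {μ | H ≤ μ.1}
  have hδ : ∀ μ ∈ S H₁, 0 < μ.1 ^ (-a) ∧ μ.1 ^ (-a) ≤ 1 / 2 := fun μ hμ =>
    ⟨Real.rpow_pos_of_pos (by linarith [show H₁ ≤ μ.1 from hμ]) _, (hH₁ _ hμ).1⟩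
  have hε : ∀ μ ∈ S H₁, 0 < μ.1 ^ (a - 1) ∧ μ.1 ^ (a - 1) ≤ 1 / 2 := fun μ hμ =>
    ⟨Real.rpow_pos_of_pos (by linarith [show H₁ ≤ μ.1 from hμ]) _, (hH₁ _ hμ).2⟩
  let U : Set (ℝ × ℝ) := ball 0 1
  let V : Set ℝ := ball 0 (2 * M + 1)
  have hW : IsOpen (U ×ˢ V) := isOpen_ball.prod isOpen_ball
  have hWb : Bornology.IsBounded (U ×ˢ V) := isBounded_ball.prod isBounded_ball
  have hs : UnifBddCn (n + 1) (S H₁) (U ×ˢ V) (fun _ z => z.1.1) :=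
    UnifBddCn.clm ((ContinuousLinearMap.fst ℝ ℝ ℝ).comp (ContinuousLinearMap.fst ℝ (ℝ × ℝ) ℝ)) hW hWb
  have hτ : UnifBddCn (n + 1) (S H₁) (U ×ˢ V) (fun _ z => z.1.2) :=
    UnifBddCn.clm ((ContinuousLinearMap.snd ℝ ℝ ℝ).comp (ContinuousLinearMap.fst ℝ (ℝ × ℝ) ℝ)) hW hWb
  have hy : UnifBddCn (n + 1) (S H₁) (U ×ˢ V) (fun _ z => z.2) :=
    UnifBddCn.clm (ContinuousLinearMap.snd ℝ (ℝ × ℝ) ℝ) hW hWb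
  have hU1 : ∀ x ∈ U, |x.1| < 1 := fun x hx =>
    lt_of_le_of_lt (norm_fst_le x) (mem_ball_zero_iff.1 hx)
  have hsmap : ∀ μ ∈ S H₁, MapsTo (fun z : (ℝ × ℝ) × ℝ => z.1.1) (U ×ˢ V) (ball 0 1) :=
    fun μ _ z hz => mem_ball_zero_iff.2 (hU1 _ hz.1)
  have hδabs : ∀ μ ∈ S H₁, |μ.1 ^ (-a)| ≤ 1 := fun μ hμ => by
    rw [abs_of_pos (hδ μ hμ).1]; linarith [(hδ μ hμ).2]
  have hδs : ∀ μ ∈ S H₁, ∀ x ∈ ball (0 : ℝ) 1, |μ.1 ^ (-a) * x| ≤ 1 / 2 := fun μ hμ x hx => by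
    rw [abs_mul, abs_of_pos (hδ μ hμ).1]
    have := (mem_ball_zero_iff.1 hx).le
    rw [Real.norm_eq_abs] at this
    nlinarith [hδ μ hμ, abs_nonneg x]
  have hP : ∀ b : ℝ, UnifBddCn (n + 1) (S H₁) (U ×ˢ V)
      (fun μ z => (1 + μ.1 ^ (-a) * z.1.1) ^ b) := fun b =>
    ((UnifBddCn.one_add_mul_rpow (n + 1) isOpen_ball hδabs hδs (c := fun _ => 1) (C := 1)
      (by simp) b).comp hs hsmap).congr (by simp)
  have hF : UnifBddCn (n + 1) (S H₁) (U ×ˢ V) (fun μ z => f (μ.2.1 + z.1.2)) :=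
    (hf.comp_const_add isOpen_univ (fun μ : ℝ × ℝ × ℝ => μ.2.1)).comp hτ
      (fun _ _ => mapsTo_univ _ _)
  let Z : ℝ × ℝ × ℝ → (ℝ × ℝ) × ℝ → ℝ := fun μ z =>
    A * ω ^ (a - 1) * v μ.2.2 * f (μ.2.1 + z.1.2) * (1 + μ.1 ^ (-a) * z.1.1) ^ (a - 1) +
      1 / ω * z.2 * (1 + μ.1 ^ (-a) * z.1.1) ^ (-1 : ℝ)
  have hvc : ∀ k : ℝ, ∀ μ ∈ S H₁, |k * v μ.2.2| ≤ |k| * Vb := fun k μ _ => by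
    rw [abs_mul]
    exact mul_le_mul_of_nonneg_left (hv _) (abs_nonneg k)
  have hZ : UnifBddCn (n + 1) (S H₁) (U ×ˢ V) Z :=
    ((hF.const_mul (c := fun μ => A * ω ^ (a - 1) * v μ.2.2) (hvc _)).mul (hP (a - 1))).add
      ((hy.const_mul (c := fun _ => 1 / ω) (fun _ _ => le_rfl)).mul (hP (-1)))
  obtain ⟨B, hB0, hB⟩ := hZ.exists_norm_le
  obtain ⟨H₂, hH₂1, hH₂⟩ := exists_rpow_small ha ha2
    (by positivity : (0 : ℝ) < 1 / 2 / (B + 1))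
  have hsub : S (max H₁ H₂) ⊆ S H₁ := fun μ (hμ : _ ≤ μ.1) =>
    (le_max_left H₁ H₂).trans hμ
  have hεB : ∀ μ ∈ S (max H₁ H₂), ∀ x ∈ ball (0 : ℝ) (B + 1), |μ.1 ^ (a - 1) * x| ≤ 1 / 2 := by
    intro μ hμ x hx
    have h1 := (hH₂ _ ((le_max_right _ _).trans hμ)).2
    rw [le_div_iff₀ (by positivity)] at h1
    have h2 := (mem_ball_zero_iff.1 hx).le
    rw [Real.norm_eq_abs] at h2
    rw [abs_mul, abs_of_pos (hε μ (hsub hμ)).1]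
    nlinarith [(hε μ (hsub hμ)).1]
  have hg := (UnifBddCn.mul_one_add_mul_rpow_sub_one (n + 1) (S := S (max H₁ H₂))
    (s := ball 0 (B + 1)) isOpen_ball isBounded_ball (ε := fun μ => μ.1 ^ (a - 1))
    (fun μ hμ => by
      rw [abs_of_pos (hε μ (hsub hμ)).1]; linarith [(hε μ (hsub hμ)).2]) hεB
    (c := fun μ => μ.1 ^ a) (C := 1) (fun μ hμ => by
      have h1 : 1 ≤ μ.1 := hH₁1.trans (hsub hμ)
      rw [← Real.rpow_add (by linarith), abs_of_pos (Real.rpow_pos_of_pos (by linarith) _)]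
      exact Real.rpow_le_one_of_one_le_of_nonpos h1 (by linarith)) ha.le (by linarith)).comp
    (hZ.mono_index hsub) (fun μ hμ z hz => mem_ball_zero_iff.2
      (lt_of_le_of_lt (hB μ (hsub hμ) z hz) (lt_add_one B)))
  have hq := (UnifBddCn.mul_one_add_mul_rpow_sub_one (n + 1) (S := S H₁)
    (s := ball 0 1) isOpen_ball isBounded_ball hδabs hδs
    (c := fun μ => μ.1 ^ a) (C := 1) (fun μ hμ => by
      have h1 : 1 ≤ μ.1 := hH₁1.trans hμ
      rw [← Real.rpow_add (by linarith)]
      simp) ha.le (by linarith)).comp hs hsmap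
  have hD := ((hP a).mono_index hsub).mul hg |>.const_mul (c := fun _ => ω ^ a)
    (fun _ _ => le_rfl)
  have hu := (hD.add ((hq.mono_index hsub).const_mul (c := fun _ => ω ^ a)
    (fun _ _ => le_rfl))).const_mul (c := fun μ => e * v μ.2.2) (fun μ hμ => hvc e μ (hsub hμ))
  have hGu := (hG.comp_const_add isOpen_univ
    (fun μ : ℝ × ℝ × ℝ => (e * v μ.2.2 * (ω ^ a * μ.1 ^ a), μ.2.1))).comp
    (hu.prodMk (hτ.mono_index hsub)) (fun _ _ => mapsTo_univ _ _)
  have hK := (((hF.mono_index hsub).const_mul (c := fun μ => A * v μ.2.2)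
    (fun μ hμ => hvc A μ (hsub hμ))).mul hD).add
    (hGu.const_mul (c := fun _ => -c) (fun _ _ => le_rfl))
  obtain ⟨η, hη0, hη⟩ := hK.of_implicit isOpen_ball isBounded_ball (convex_ball _ _)
    (convex_ball _ _)
  obtain ⟨H₃, hH₃1, hH₃⟩ := exists_rpow_small ha ha2 hη0
  let H := max (max H₁ H₂) (max H₃ (2 * h₁))
  have hsub' : S H ⊆ S (max H₁ H₂) := fun μ (hμ : _ ≤ μ.1) => (le_max_left _ _).trans hμ
  have hw := hη (S H) hsub' (fun μ => μ.1 ^ (-a))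
    (fun μ hμ => ⟨(hδ μ (hsub (hsub' hμ))).1.le,
      (hH₃ _ (((le_max_left _ _).trans (le_max_right _ _)).trans hμ)).1⟩)
    (fun μ x => R₁ (μ.1 + μ.1 ^ (1 - a) * x.1) (μ.2.1 + x.2) μ.2.2) (by
      rintro ⟨h, t, θ⟩ hμ ⟨s, τ⟩ hx
      have hh : H ≤ h := hμ
      have h1 : 1 ≤ h := hH₁1.trans (hsub (hsub' hμ))
      have hh0 : 0 < h := by linarith
      have hh1 : 2 * h₁ ≤ h := ((le_max_right _ _).trans (le_max_right _ _)).trans hh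
      have hρ := abs_le.1 (hδs _ (hsub (hsub' hμ)) s (mem_ball_zero_iff.2 (hU1 _ hx)))
      simp only at hρ ⊢
      have hstep : h + h ^ (1 - a) * s = h * (1 + h ^ (-a) * s) := by
        rw [show 1 - a = -a + 1 by ring, Real.rpow_add_one hh0.ne']; ring
      rw [hstep]
      have hinv : h ^ (-a) * h ^ a = 1 := by rw [← Real.rpow_add hh0]; simp
      have hρ0 : 0 < 1 + h ^ (-a) * s := by linarith
      obtain ⟨hle, heq⟩ := hR₁ (h * (1 + h ^ (-a) * s)) (by nlinarith) (t + τ) θ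
      have hy' : h ^ (-a) * R₁ (h * (1 + h ^ (-a) * s)) (t + τ) θ ∈ V := by
        have h2 : (h * (1 + h ^ (-a) * s)) ^ a ≤ 2 * h ^ a := by
          rw [mul_comm 2, Real.mul_rpow hh0.le hρ0.le]
          refine mul_le_mul_of_nonneg_left ?_ (by positivity)
          calc (1 + h ^ (-a) * s) ^ a ≤ 2 ^ a :=
                Real.rpow_le_rpow hρ0.le (by linarith) ha.le
            _ ≤ 2 ^ (1 : ℝ) := Real.rpow_le_rpow_of_exponent_le one_le_two (by linarith)
            _ = 2 := Real.rpow_one 2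
        refine mem_ball_zero_iff.2 ?_
        rw [Real.norm_eq_abs, abs_mul, abs_of_pos (Real.rpow_pos_of_pos hh0 _)]
        calc _ ≤ h ^ (-a) * (M * (2 * h ^ a)) := mul_le_mul_of_nonneg_left
                (hle.trans (mul_le_mul_of_nonneg_left h2 hM)) (by positivity)
          _ = 2 * M * (h ^ (-a) * h ^ a) := by ring
          _ < 2 * M + 1 := by rw [hinv]; linarith
      refine ⟨hy', ?_⟩
      have hZ0 := hB (h, t, θ) (hsub (hsub' hμ))
        ((s, τ), h ^ (-a) * R₁ (h * (1 + h ^ (-a) * s)) (t + τ) θ) ⟨hx, hy'⟩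
      have hZ1 := abs_le.1 (hεB (h, t, θ) (hsub' hμ) _
        (mem_ball_zero_iff.2 (lt_of_le_of_lt hZ0 (lt_add_one B))))
      have hr := rescaled_radius_eq (a := a) (A := A) (V := v θ) (F := f (t + τ))
        (w := R₁ (h * (1 + h ^ (-a) * s)) (t + τ) θ) hω hh0 hρ0 rfl
      simp only [Z, Prod.mk_add_mk] at hZ1 ⊢
      rw [hr, Real.mul_rpow (by positivity) (by linarith), Real.mul_rpow hω.le (by positivity),
        Real.mul_rpow hh0.le hρ0.le] at heq
      refine heq.trans ?_
      rw [sub_eq_add_neg, ← neg_mul]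
      congr 1
      · ring
      · congr 2
        ring)
  obtain ⟨C', hC'0, hC'⟩ := hw.exists_iterD_le
  refine ⟨C', H, hC'0, hH₁1.trans ((le_max_left _ _).trans (le_max_left _ _)),
    fun i j hij θ t h hh => ?_⟩
  have h1 := hC' i j hij (h, t, θ) hh 0 (mem_ball_self one_pos)
  have h2 := iterD_comp_affine (fun h t => R₁ h t θ) i j h (h ^ (1 - a)) t
  have hh0 : 0 < h := by
    have : H₁ ≤ h := hsub (hsub' (show (h, t, θ) ∈ S H from hh))
    linarith
  have h3 : 0 < h ^ (1 - a) := Real.rpow_pos_of_pos hh0 _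
  rw [← abs_of_pos (pow_pos h3 i), ← abs_mul, ← h2]
  exact h1

end Aux

/-- **Lemma 2.7.** Define `R₁` by
`R = −ω^p d^{1/p}(ωh)^{1/p} v(θ) f(t) − R₁(h,t,θ)`.  Then
`|D_h^i D_t^j R₁(h,t,θ)| ≤ C' h^{-i/q}` for `0 ≤ i+j ≤ 21` and all large `h`. -/
theorem R1_estimates
    (p q a₁ b₁ d ω C : ℝ) (v v' f : ℝ → ℝ) (G : ℝ → ℝ → ℝ)
    (f₁ : ℝ → ℝ → ℝ → ℝ) (R R₁ : ℝ → ℝ → ℝ → ℝ)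
    (hp : 2 ≤ p) (hq : q = p / (p - 1))
    (ha₁ : 0 < a₁) (hb₁ : 0 < b₁)
    (hab : a₁ ^ (-(1 : ℝ) / p) + b₁ ^ (-(1 : ℝ) / p) = 2)
    (hd : d = p / a₁) (hω : 0 < ω)
    -- `v`
    (hv : ∀ t, HasDerivAt v (v' t) t)
    (hode : ∀ t, HasDerivAt (fun s => phi p (v' s))
      (-a₁ * phi p (max (v t) 0) + b₁ * phi p (max (-v t) 0)) t)
    (hv0 : v 0 = (p - 1) ^ (1 / p)) (hv'0 : v' 0 = 0)
    -- `f`, `G`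
    (hf : ContDiff ℝ 23 f) (hfper : Function.Periodic f (2 * pip p))
    (hG : ContDiff ℝ 21 (fun z : ℝ × ℝ => G z.1 z.2))
    (hGper : ∀ x t, G x (t + 2 * pip p) = G x t)
    (hC : 0 < C)
    (hGbd : ∀ i j : ℕ, i + j ≤ 21 → ∀ x t : ℝ, |iterD G i j x t| ≤ C)
    -- `f₁`
    (hf₁ : ∀ r θ t : ℝ, f₁ r θ t = ω ^ (p - 1) * G (d ^ (1 / p) * r ^ (1 / p) * v θ) t)
    -- `R`: implicit equation and a priori bound, for large `h`
    (hR : ∃ h₁ : ℝ, ∀ h : ℝ, h₁ ≤ h → ∀ t θ : ℝ,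
      R h t θ = ω * f₁ (ω * h - R h t θ) θ t
        - ω ^ p * d ^ (1 / p) * (ω * h - R h t θ) ^ (1 / p) * v θ * f t ∧
      |R h t θ| ≤ ω * h / 2)
    -- definition of `R₁`
    (hR₁ : ∀ h t θ : ℝ,
      R h t θ = -(ω ^ p * d ^ (1 / p) * (ω * h) ^ (1 / p) * v θ * f t) - R₁ h t θ) :
    ∃ C' h₀ : ℝ, 0 < C' ∧ ∀ i j : ℕ, i + j ≤ 21 → ∀ θ t h : ℝ, h₀ ≤ h →
      |iterD (fun h t => R₁ h t θ) i j h t| ≤ C' * h ^ (-(i : ℝ) / q) := by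
  obtain ⟨h₁, hR⟩ := hR
  have hp0 : 0 < p := by linarith
  have hd0 : 0 < d := hd ▸ div_pos hp0 ha₁
  have ha0 : 0 < 1 / p := by positivity
  have ha2 : 1 / p ≤ 1 / 2 := one_div_le_one_div_of_le two_pos hp
  have hperiod : 0 < 2 * pip p := mul_pos two_pos (pip_pos hp)
  obtain ⟨Vb, hVb⟩ := exists_abs_le_of_asymmetric_oscillator hp ha₁ hb₁ hv hode
  obtain ⟨Fb, hFb⟩ := hfper.exists_abs_le hperiod hf.continuous
  have hVb0 : 0 ≤ Vb := (abs_nonneg _).trans (hVb 0)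
  have hFb0 : 0 ≤ Fb := (abs_nonneg _).trans (hFb 0)
  have hf' : UnifBddCn (20 + 1) (Set.univ : Set Unit) Set.univ (fun _ => f) :=
    hfper.unifBddCn hperiod (hf.of_le (by norm_num))
  have hG' : UnifBddCn (20 + 1) (Set.univ : Set Unit) Set.univ
      (fun _ (z : ℝ × ℝ) => G z.1 z.2) :=
    UnifBddCn.of_iterD (by exact_mod_cast hG) hGbd
  set a := 1 / p with ha_def
  set A := ω ^ p * d ^ a with hA
  have hA0 : 0 < A := by positivity
  set c := ω * ω ^ (p - 1) with hc
  have hc0 : 0 < c := by positivity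
  have hM : 0 ≤ c * C + A * Vb * Fb * (2 * ω) ^ a := by positivity
  obtain ⟨C', h₀, hC', hh₀, hbd⟩ := exists_iterD_remainder_le (R₁ := R₁) (A := A) (c := c)
    (e := d ^ a) (h₁ := max 1 h₁) ha0 ha2 hω hVb hf' hG' hM (fun h hh t θ => by
      have h1 : 1 ≤ h := (le_max_left _ _).trans hh
      have hh0 : 0 < h := by linarith
      obtain ⟨heq, hle⟩ := hR h ((le_max_right _ _).trans hh) t θ
      have hr : ω * h + A * (ω * h) ^ a * v θ * f t + R₁ h t θ = ω * h - R h t θ := by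
        rw [hR₁ h t θ]; ring
      rw [hr]
      rw [hf₁] at heq
      have hR₁eq : R₁ h t θ = A * v θ * f t * ((ω * h - R h t θ) ^ a - (ω * h) ^ a)
          - c * G (d ^ a * (ω * h - R h t θ) ^ a * v θ) t := by
        linear_combination -heq + hR₁ h t θ
      refine ⟨?_, hR₁eq⟩
      have hωh : 0 < ω * h := by positivity
      have hle' := abs_le.1 hle
      have hbound : ∀ r, 0 ≤ r → r ≤ 2 * ω * h → r ^ a ≤ (2 * ω) ^ a * h ^ a := fun r h0 hr => by
        rw [← Real.mul_rpow (by positivity) hh0.le]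
        exact Real.rpow_le_rpow h0 hr ha0.le
      have hdiff : |(ω * h - R h t θ) ^ a - (ω * h) ^ a| ≤ (2 * ω) ^ a * h ^ a := by
        have e1 := hbound (ω * h - R h t θ) (by linarith) (by linarith)
        have e2 := hbound (ω * h) (by linarith) (by linarith)
        have e3 : 0 ≤ (ω * h - R h t θ) ^ a := Real.rpow_nonneg (by linarith) _
        have e4 : 0 ≤ (ω * h) ^ a := by positivity
        exact abs_le.2 ⟨by linarith, by linarith⟩
      have hGC : |G (d ^ a * (ω * h - R h t θ) ^ a * v θ) t| ≤ C := by
        simpa [iterD] using hGbd 0 0 (by norm_num) (d ^ a * (ω * h - R h t θ) ^ a * v θ) t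
      rw [hR₁eq]
      refine (abs_sub _ _).trans ?_
      rw [abs_mul (A * v θ * f t), abs_mul (A * v θ), abs_mul A, abs_mul c, abs_of_pos hA0, abs_of_pos hc0]
      have h1a : 1 ≤ h ^ a := Real.one_le_rpow h1 ha0.le
      calc _ ≤ A * Vb * Fb * ((2 * ω) ^ a * h ^ a) + c * C * h ^ a := by
            refine add_le_add ?_ ?_
            · gcongr
              · exact hVb θ
              · exact hFb t
            · calc _ ≤ c * C := by gcongr
                _ ≤ c * C * h ^ a := le_mul_of_one_le_right (by positivity) h1a
        _ = _ := by ring)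
  refine ⟨C', h₀, hC', fun i j hij θ t h hh => ?_⟩
  have hh0 : 0 < h := by linarith
  have hpow : h ^ (-(i : ℝ) / q) = ((h ^ (1 - a)) ^ i)⁻¹ := by
    have hp1 : p - 1 ≠ 0 := by linarith
    rw [← Real.rpow_mul_natCast hh0.le, ← Real.rpow_neg hh0.le]
    congr 1
    rw [hq, ha_def]
    field_simp
  rw [hpow, ← div_eq_mul_inv, le_div_iff₀' (by positivity)]
  exact hbd i j hij θ t h hh
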